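/- Let n ≥ 1, 0 < p₁, p₂, q₁, q₂ < ∞, let v₁, v₂ be weights on ℝⁿ and w₁, w₂ nonnegative measurable functions on (0,∞). Define ṽ_i(y) := v_i(y/|y|²) |y|^{-2n/p_i} for y ∈ ℝⁿ \ {0} and w̃_i(τ) := τ^{-2/q_i} w_i(1/τ) for τ > 0, i = 1,2. Then there exists a constant C such that ‖f‖_{∁LM_{p₂,q₂}(v₂,w₂)} ≤ C ‖f‖_{∁LM_{p₁,q₁}(v₁,w₁)} for all nonnegative measurable f on ℝⁿ if and only if there exists a constant C such that ‖g‖_{LM_{p₂,q₂}(ṽ₂,w̃₂)} ≤ C ‖g‖_{LM_{p₁,q₁}(ṽ₁,w̃₁)} for all nonnegative measurable g on ℝⁿ; indeed the change of variables x = y/|y|², t = 1/τ gives ‖f‖_{∁LM_{p,q}(v,w)} = ‖f ∘ ι‖_{LM_{p,q}(ṽ,w̃)} where ι(y) := y/|y|². -/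

import Mathlib

open MeasureTheory Set ENNReal

noncomputable section

/-- The set `B(a,b) = {y ∈ ℝⁿ : a < |y| < b}`. -/
def annulus (n : ℕ) (a b : ℝ) : Set (EuclideanSpace ℝ (Fin n)) :=
  {y | a < ‖y‖ ∧ ‖y‖ < b}

/-- The weighted local Morrey-type functional `‖f‖_{LM_{p,q}(v,w)}`. -/
def LMnorm (n : ℕ) (p q : ℝ) (v : EuclideanSpace ℝ (Fin n) → ℝ≥0∞) (w : ℝ → ℝ≥0∞)
    (f : EuclideanSpace ℝ (Fin n) → ℝ≥0∞) : ℝ≥0∞ :=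
  (∫⁻ t in Ioi (0 : ℝ), (∫⁻ s in annulus n 0 t, f s ^ p * v s ^ p) ^ (q / p) * w t ^ q) ^ (1 / q)

/-- The weighted complementary local Morrey-type functional `‖f‖_{∁LM_{p,q}(v,w)}`. -/
def CLMnorm (n : ℕ) (p q : ℝ) (v : EuclideanSpace ℝ (Fin n) → ℝ≥0∞) (w : ℝ → ℝ≥0∞)
    (f : EuclideanSpace ℝ (Fin n) → ℝ≥0∞) : ℝ≥0∞ :=
  (∫⁻ t in Ioi (0 : ℝ),
    (∫⁻ s in {s : EuclideanSpace ℝ (Fin n) | t ≤ ‖s‖}, f s ^ p * v s ^ p) ^ (q / p) *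
      w t ^ q) ^ (1 / q)

/-- The inversion `ι(y) = y/|y|²`. -/
def inv₂ (n : ℕ) (y : EuclideanSpace ℝ (Fin n)) : EuclideanSpace ℝ (Fin n) :=
  (‖y‖ ^ 2)⁻¹ • y

theorem inv₂_inv₂ (n : ℕ) (y : EuclideanSpace ℝ (Fin n)) : inv₂ n (inv₂ n y) = y := by
  by_cases hy : y = 0
  · simp [inv₂, hy]
  · have h : ‖y‖ ≠ 0 := by simpa using hy
    unfold inv₂
    rw [norm_smul, smul_smul, norm_inv, norm_pow, norm_norm]
    have : ((((‖y‖ ^ 2)⁻¹ * ‖y‖) ^ 2)⁻¹ * (‖y‖ ^ 2)⁻¹) = 1 := by field_simp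
    rw [this, one_smul]

theorem norm_inv₂ (n : ℕ) (y : EuclideanSpace ℝ (Fin n)) : ‖inv₂ n y‖ = ‖y‖⁻¹ := by
  by_cases hy : y = 0
  · simp [inv₂, hy]
  · have h : ‖y‖ ≠ 0 := by simpa using hy
    unfold inv₂
    rw [norm_smul, norm_inv, norm_pow, norm_norm]
    field_simp

theorem measurable_inv₂ (n : ℕ) : Measurable (inv₂ n) := by
  unfold inv₂
  fun_prop

theorem inv₂_eq (n : ℕ) : inv₂ n = EuclideanGeometry.inversion 0 1 := by
  ext y
  simp [inv₂, EuclideanGeometry.inversion]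

theorem change_inner (n : ℕ) (G : EuclideanSpace ℝ (Fin n) → ℝ≥0∞) (τ : ℝ) (hτ : 0 < τ) :
    ∫⁻ s in {s : EuclideanSpace ℝ (Fin n) | 1 / τ ≤ ‖s‖}, G s =
      ∫⁻ y in annulus n 0 τ, G (inv₂ n y) * ENNReal.ofReal (‖y‖ ^ (-(2 * (n : ℝ)))) := by
  set S : Set (EuclideanSpace ℝ (Fin n)) := {y | 0 < ‖y‖ ∧ ‖y‖ ≤ τ} with hS
  have hSm : MeasurableSet S :=
    (measurableSet_lt measurable_const measurable_norm).inter
      (measurableSet_le measurable_norm measurable_const)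
  have himg : {s : EuclideanSpace ℝ (Fin n) | 1 / τ ≤ ‖s‖} = inv₂ n '' S := by
    ext s
    simp only [mem_setOf_eq, mem_image, hS]
    constructor
    · intro h
      have hs : 0 < ‖s‖ := lt_of_lt_of_le (by positivity) h
      refine ⟨inv₂ n s, ⟨?_, ?_⟩, inv₂_inv₂ n s⟩
      · rw [norm_inv₂]; positivity
      · rw [norm_inv₂]; exact inv_le_of_inv_le₀ hτ (by simpa using h)
    · rintro ⟨y, ⟨h0, h1⟩, rfl⟩
      rw [norm_inv₂, one_div]
      exact inv_anti₀ h0 h1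
  have hae : annulus n 0 τ =ᵐ[volume] S := by
    have h0 : volume (Metric.sphere (0 : EuclideanSpace ℝ (Fin n)) τ) = 0 :=
      Measure.addHaar_sphere_of_ne_zero _ _ hτ.ne'
    have h1 : ∀ᵐ x ∂(volume : Measure (EuclideanSpace ℝ (Fin n))), x ∉ Metric.sphere 0 τ :=
      measure_eq_zero_iff_ae_notMem.1 h0
    filter_upwards [h1] with x hx
    have hx' : ‖x‖ ≠ τ := by simpa using hx
    apply propext
    change (0 < ‖x‖ ∧ ‖x‖ < τ) ↔ (0 < ‖x‖ ∧ ‖x‖ ≤ τ)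
    exact and_congr_right fun _ => ⟨le_of_lt, fun h => lt_of_le_of_ne h hx'⟩
  rw [himg, setLIntegral_congr hae]
  have hd : ∀ x ∈ S, HasFDerivWithinAt (inv₂ n)
      ((1 / dist x 0) ^ 2 • ((ℝ ∙ (x - 0))ᗮ.reflection :
        EuclideanSpace ℝ (Fin n) →L[ℝ] EuclideanSpace ℝ (Fin n))) S x := by
    intro x hx
    rw [inv₂_eq]
    exact (EuclideanGeometry.hasFDerivAt_inversion (norm_pos_iff.1 hx.1)).hasFDerivWithinAt
  have hinj : InjOn (inv₂ n) S := fun a _ b _ h => by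
    rw [← inv₂_inv₂ n a, h, inv₂_inv₂]
  rw [lintegral_image_eq_lintegral_abs_det_fderiv_mul volume hSm hd hinj]
  refine setLIntegral_congr_fun hSm fun x hx => ?_
  have hx0 : 0 < ‖x‖ := hx.1
  rw [mul_comm]
  congr 2
  rw [ContinuousLinearMap.det, ContinuousLinearMap.coe_smul, LinearMap.det_smul]
  have hr : |LinearMap.det (((ℝ ∙ (x - 0))ᗮ.reflection :
        EuclideanSpace ℝ (Fin n) →L[ℝ] EuclideanSpace ℝ (Fin n)) :
        EuclideanSpace ℝ (Fin n) →ₗ[ℝ] EuclideanSpace ℝ (Fin n))| = 1 := by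
    have := (ℝ ∙ (x - 0))ᗮ.det_reflection
    erw [this]
    simp
  rw [abs_mul, hr, mul_one, finrank_euclideanSpace_fin, abs_of_nonneg (by positivity), dist_zero_right,
    Real.rpow_neg hx0.le, one_div, ← pow_mul, inv_pow]
  congr 1
  rw [← Real.rpow_natCast]
  push_cast
  rfl

theorem change_outer (H : ℝ → ℝ≥0∞) :
    ∫⁻ t in Ioi (0 : ℝ), H t =
      ∫⁻ τ in Ioi (0 : ℝ), H (1 / τ) * ENNReal.ofReal (τ ^ (-2 : ℝ)) := by
  have himg : Ioi (0 : ℝ) = (fun t : ℝ => t⁻¹) '' Ioi 0 := by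
    ext t
    simp only [mem_image, mem_Ioi]
    exact ⟨fun h => ⟨t⁻¹, by positivity, inv_inv t⟩, by rintro ⟨x, hx, rfl⟩; positivity⟩
  conv_lhs => rw [himg]
  rw [lintegral_image_eq_lintegral_abs_deriv_mul measurableSet_Ioi
    (fun x hx => (hasDerivAt_inv (ne_of_gt hx)).hasDerivWithinAt)
    (fun a _ b _ h => inv_injective h)]
  refine setLIntegral_congr_fun measurableSet_Ioi fun x hx => ?_
  have hx0 : (0 : ℝ) < x := hx
  simp only [one_div]
  rw [mul_comm, abs_neg, abs_of_nonneg (by positivity), Real.rpow_neg hx0.le, Real.rpow_two]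

theorem CLM_eq_LM (n : ℕ) (p q : ℝ) (hp : 0 < p) (hq : 0 < q)
    (v : EuclideanSpace ℝ (Fin n) → ℝ≥0∞) (w : ℝ → ℝ≥0∞)
    (f : EuclideanSpace ℝ (Fin n) → ℝ≥0∞) :
    CLMnorm n p q v w f = LMnorm n p q
      (fun y => v (inv₂ n y) * ENNReal.ofReal (‖y‖ ^ (-(2 * (n : ℝ) / p))))
      (fun τ => ENNReal.ofReal (τ ^ (-2 / q)) * w (1 / τ)) (f ∘ inv₂ n) := by
  unfold CLMnorm LMnorm
  congr 1
  rw [change_outer]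
  refine setLIntegral_congr_fun measurableSet_Ioi fun τ hτ => ?_
  have hτ0 : (0 : ℝ) < τ := hτ
  simp only
  rw [change_inner n _ τ hτ0, mul_assoc]
  have key : ∀ (a r b : ℝ), 0 ≤ a → 0 < r →
      (ENNReal.ofReal (a ^ (b / r))) ^ r = ENNReal.ofReal (a ^ b) := by
    intro a r b ha hr
    rw [ENNReal.ofReal_rpow_of_nonneg (by positivity) hr.le, ← Real.rpow_mul ha,
      div_mul_cancel₀ _ hr.ne']
  congr 1
  · congr 1
    refine lintegral_congr fun y => ?_
    rw [ENNReal.mul_rpow_of_nonneg _ _ hp.le, ← neg_div, key _ _ _ (norm_nonneg y) hp, mul_assoc]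
    rfl
  · rw [ENNReal.mul_rpow_of_nonneg _ _ hq.le, key _ _ _ hτ0.le hq, mul_comm]

theorem statement16 (n : ℕ) (hn : 1 ≤ n) (p₁ p₂ q₁ q₂ : ℝ)
    (hp₁ : 0 < p₁) (hp₂ : 0 < p₂) (hq₁ : 0 < q₁) (hq₂ : 0 < q₂)
    (v₁ v₂ : EuclideanSpace ℝ (Fin n) → ℝ≥0∞) (w₁ w₂ : ℝ → ℝ≥0∞)
    (hv₁m : Measurable v₁)
    (hv₁ : ∀ᵐ x ∂(volume : Measure (EuclideanSpace ℝ (Fin n))), 0 < v₁ x ∧ v₁ x < ⊤)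
    (hv₂m : Measurable v₂)
    (hv₂ : ∀ᵐ x ∂(volume : Measure (EuclideanSpace ℝ (Fin n))), 0 < v₂ x ∧ v₂ x < ⊤)
    (hw₁m : Measurable w₁) (hw₂m : Measurable w₂) :
    let tv₁ : EuclideanSpace ℝ (Fin n) → ℝ≥0∞ := fun y =>
      v₁ (inv₂ n y) * ENNReal.ofReal (‖y‖ ^ (-(2 * (n : ℝ) / p₁)))
    let tv₂ : EuclideanSpace ℝ (Fin n) → ℝ≥0∞ := fun y =>
      v₂ (inv₂ n y) * ENNReal.ofReal (‖y‖ ^ (-(2 * (n : ℝ) / p₂)))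
    let tw₁ : ℝ → ℝ≥0∞ := fun τ => ENNReal.ofReal (τ ^ (-2 / q₁)) * w₁ (1 / τ)
    let tw₂ : ℝ → ℝ≥0∞ := fun τ => ENNReal.ofReal (τ ^ (-2 / q₂)) * w₂ (1 / τ)
    (∀ f : EuclideanSpace ℝ (Fin n) → ℝ≥0∞, Measurable f →
      CLMnorm n p₁ q₁ v₁ w₁ f = LMnorm n p₁ q₁ tv₁ tw₁ (f ∘ inv₂ n)) ∧
    (∀ f : EuclideanSpace ℝ (Fin n) → ℝ≥0∞, Measurable f →
      CLMnorm n p₂ q₂ v₂ w₂ f = LMnorm n p₂ q₂ tv₂ tw₂ (f ∘ inv₂ n)) ∧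
    ((∃ C : ℝ≥0∞, C ≠ ⊤ ∧ ∀ f : EuclideanSpace ℝ (Fin n) → ℝ≥0∞, Measurable f →
        CLMnorm n p₂ q₂ v₂ w₂ f ≤ C * CLMnorm n p₁ q₁ v₁ w₁ f) ↔
      (∃ C : ℝ≥0∞, C ≠ ⊤ ∧ ∀ g : EuclideanSpace ℝ (Fin n) → ℝ≥0∞, Measurable g →
        LMnorm n p₂ q₂ tv₂ tw₂ g ≤ C * LMnorm n p₁ q₁ tv₁ tw₁ g)) := by
  intro tv₁ tv₂ tw₁ tw₂
  have h₁ := CLM_eq_LM n p₁ q₁ hp₁ hq₁ v₁ w₁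
  have h₂ := CLM_eq_LM n p₂ q₂ hp₂ hq₂ v₂ w₂
  refine ⟨fun f _ => h₁ f, fun f _ => h₂ f, ?_, ?_⟩
  · rintro ⟨C, hC, h⟩
    refine ⟨C, hC, fun g hg => ?_⟩
    have := h (g ∘ inv₂ n) (hg.comp (measurable_inv₂ n))
    have e : (g ∘ inv₂ n) ∘ inv₂ n = g := by
      funext y
      simp [inv₂_inv₂]
    rw [h₁, h₂, e] at this
    exact this
  · rintro ⟨C, hC, h⟩
    refine ⟨C, hC, fun f hf => ?_⟩
    rw [h₁, h₂]
    exact h _ (hf.comp (measurable_inv₂ n))
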